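/- arXiv:2001.03275 — 2 statements merged into one kernel-verified Lean document; each statement's English description precedes it below -/
import Mathlib

section
/- Let V be a finite-dimensional complex vector space, let d ≥ 2 be an integer, and let A, B, C be endomorphisms of V satisfying the Jacobi relations B∘C = C∘B, C∘A = A∘C, and A∘B − B∘A = −d·C^{d−1}. Then for every λ ∈ ℂ, the endomorphism A maps the generalized λ-eigenspace of B into itself and B maps the generalized λ-eigenspace of A into itself; moreover C maps the generalized λ-eigenspace of A into itself and the generalized λ-eigenspace of B into itself. -/
/-- The generalized `μ`-eigenspace of an endomorphism `f` of `V`: the union over `k ∈ ℕ`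
of the kernels of `(f − μ·id)^k`. -/
def genEigenspace' {K V : Type*} [Field K] [AddCommGroup V] [Module K V]
    (f : Module.End K V) (μ : K) : Submodule K V :=
  ⨆ k : ℕ, LinearMap.ker ((f - μ • (1 : Module.End K V)) ^ k)

theorem mem_gen_iff_aux {V : Type*} [AddCommGroup V] [Module ℂ V]
    (f : Module.End ℂ V) (μ : ℂ) (v : V) :
    v ∈ genEigenspace' f μ ↔ ∃ k : ℕ, ((f - μ • (1 : Module.End ℂ V)) ^ k) v = 0 := by
  unfold genEigenspace'
  rw [Submodule.mem_iSup_of_directed]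
  · simp only [LinearMap.mem_ker]
  · refine Monotone.directed_le (fun a b hab v hv => ?_)
    rw [LinearMap.mem_ker] at hv ⊢
    obtain ⟨c, rfl⟩ := Nat.exists_eq_add_of_le' hab
    rw [pow_add, Module.End.mul_apply, hv, map_zero]

theorem pow_aux {V : Type*} [AddCommGroup V] [Module ℂ V]
    (N g Z : Module.End ℂ V) (hZ : g * N - N * g = Z) (hc : Commute N Z) (k : ℕ) :
    ∀ v, (N ^ k) v = 0 → (N ^ (k + 1)) (g v) = 0 := by
  induction k with
  | zero => intro v hv; simp at hv; simp [hv]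
  | succ k ih =>
    intro v hv
    have e : N (g v) = g (N v) - Z v := by
      rw [← hZ]; simp
    have h := ih (N v) (by rw [pow_succ] at hv; exact hv)
    have h' : (N ^ (k + 1)) (Z v) = Z ((N ^ (k + 1)) v) :=
      LinearMap.congr_fun (hc.pow_left (k + 1)).eq v
    rw [pow_succ, Module.End.mul_apply, e, map_sub, h, h', hv, map_zero, sub_zero]

theorem gen_aux {V : Type*} [AddCommGroup V] [Module ℂ V]
    (f g Z : Module.End ℂ V) (hZ : g * f - f * g = Z) (hc : Commute f Z) (μ : ℂ) :
    ∀ v ∈ genEigenspace' f μ, g v ∈ genEigenspace' f μ := by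
  intro v hv
  rw [mem_gen_iff_aux] at hv ⊢
  obtain ⟨k, hk⟩ := hv
  refine ⟨k + 1, pow_aux _ g Z ?_ ?_ k v hk⟩
  · rw [← hZ]; simp [mul_sub, sub_mul]
  · exact hc.sub_left ((Commute.one_left Z).smul_left μ)

/-- If `V` is a finite-dimensional complex vector space, `d ≥ 2`, and
`A, B, C` are endomorphisms of `V` satisfying the Jacobi relations `B∘C = C∘B`,
`C∘A = A∘C`, `A∘B − B∘A = −d·C^(d−1)`, then for every `λ ∈ ℂ`: `A` maps the generalized
`λ`-eigenspace of `B` into itself, `B` maps the generalized `λ`-eigenspace of `A` into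
itself, and `C` maps the generalized `λ`-eigenspaces of both `A` and `B` into themselves. -/
theorem genEigenspace_invariant_of_jacobi_relations
    (V : Type*) [AddCommGroup V] [Module ℂ V] [FiniteDimensional ℂ V]
    (d : ℕ) (hd : 2 ≤ d) (A B C : Module.End ℂ V)
    (h1 : B * C = C * B) (h2 : C * A = A * C)
    (h3 : A * B - B * A = -((d : ℂ) • C ^ (d - 1))) :
    ∀ lam : ℂ,
      (∀ v ∈ genEigenspace' B lam, A v ∈ genEigenspace' B lam) ∧
      (∀ v ∈ genEigenspace' A lam, B v ∈ genEigenspace' A lam) ∧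
      (∀ v ∈ genEigenspace' A lam, C v ∈ genEigenspace' A lam) ∧
      (∀ v ∈ genEigenspace' B lam, C v ∈ genEigenspace' B lam) := by
  intro lam
  have hBC : Commute B C := h1
  have hAC : Commute A C := h2.symm
  refine ⟨gen_aux B A _ h3 ?_ lam, gen_aux A B ((d : ℂ) • C ^ (d - 1)) ?_ ?_ lam,
    gen_aux A C 0 ?_ (Commute.zero_right _) lam, gen_aux B C 0 ?_ (Commute.zero_right _) lam⟩
  · exact ((hBC.pow_right _).smul_right _).neg_right
  · rw [← neg_sub, h3, neg_neg]
  · exact (hAC.pow_right _).smul_right _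
  · rw [h2, sub_self]
  · rw [h1, sub_self]
end

section
/- Let V be a finite-dimensional complex vector space, let d ≥ 2 be an integer, and let A, B, C be endomorphisms of V satisfying the Jacobi relations B∘C = C∘B, C∘A = A∘C, and A∘B − B∘A = −d·C^{d−1}. For each pair (s₁, s₂) ∈ ℂ², let V_{(s₁,s₂)} denote the intersection of the generalized s₁-eigenspace of A with the generalized s₂-eigenspace of B. Then each subspace V_{(s₁,s₂)} is invariant under A, B and C, and V is the internal direct sum of the family of subspaces (V_{(s₁,s₂)})_{(s₁,s₂) ∈ ℂ²}. -/
open Module Module.End in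
theorem genEig_eq {V : Type*} [AddCommGroup V] [Module ℂ V] (f : Module.End ℂ V) (μ : ℂ) :
    genEigenspace' f μ = f.maxGenEigenspace μ := by
  rw [genEigenspace', Module.End.maxGenEigenspace, Module.End.genEigenspace_top]
  simp only [Module.End.genEigenspace_nat]

theorem mapsTo_aux {V : Type*} [AddCommGroup V] [Module ℂ V] (f g z : Module.End ℂ V)
    (hz : Commute f z) (h : f * g = g * f + z) (μ : ℂ) :
    Set.MapsTo g (f.maxGenEigenspace μ) (f.maxGenEigenspace μ) := by
  intro v hv
  simp only [SetLike.mem_coe, Module.End.mem_maxGenEigenspace] at hv ⊢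
  obtain ⟨k, hk⟩ := hv
  set N : Module.End ℂ V := f - μ • 1 with hN
  have hNz : Commute N z := by
    rw [hN]
    exact hz.sub_left ((Commute.one_left z).smul_left μ)
  have hNg : N * g = g * N + z := by
    rw [hN, sub_mul, mul_sub, h, smul_mul_assoc, mul_smul_comm, one_mul, mul_one]
    abel
  have key : ∀ n : ℕ, N ^ (n + 1) * g = g * N ^ (n + 1) + ((n : ℂ) + 1) • (z * N ^ n) := by
    intro n
    induction n with
    | zero => simp [hNg]
    | succ n ih =>
      rw [pow_succ' N (n + 1), mul_assoc, ih, mul_add, ← mul_assoc N g, hNg, add_mul,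
        mul_smul_comm, ← mul_assoc N z, hNz.eq, mul_assoc z N, ← pow_succ', mul_assoc g N]
      push_cast
      module
  refine ⟨k + 1, ?_⟩
  have e := congrArg (fun T : Module.End ℂ V => T v) (key k)
  simp only [Module.End.mul_apply, LinearMap.add_apply, LinearMap.smul_apply] at e
  rw [e, pow_succ', Module.End.mul_apply, hk]
  simp

/-- If `V` is a finite-dimensional complex vector space, `d ≥ 2`, and
`A, B, C` are endomorphisms of `V` satisfying the Jacobi relations `B∘C = C∘B`,
`C∘A = A∘C`, `A∘B − B∘A = −d·C^(d−1)`, and for each `(s₁, s₂) ∈ ℂ²` we let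
`V_(s₁,s₂)` be the intersection of the generalized `s₁`-eigenspace of `A` with the
generalized `s₂`-eigenspace of `B`, then each `V_(s₁,s₂)` is invariant under `A`, `B`
and `C`, and `V` is the internal direct sum of the family `(V_(s₁,s₂))`, i.e. the family
is independent and spans `V`. -/
theorem isInternal_genEigenspaces_of_jacobi_relations
    (V : Type*) [AddCommGroup V] [Module ℂ V] [FiniteDimensional ℂ V]
    (d : ℕ) (hd : 2 ≤ d) (A B C : Module.End ℂ V)
    (h1 : B * C = C * B) (h2 : C * A = A * C)
    (h3 : A * B - B * A = -((d : ℂ) • C ^ (d - 1)))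
    (W : ℂ × ℂ → Submodule ℂ V)
    (hW : ∀ s : ℂ × ℂ, W s = genEigenspace' A s.1 ⊓ genEigenspace' B s.2) :
    (∀ s : ℂ × ℂ, ∀ v ∈ W s, A v ∈ W s) ∧
    (∀ s : ℂ × ℂ, ∀ v ∈ W s, B v ∈ W s) ∧
    (∀ s : ℂ × ℂ, ∀ v ∈ W s, C v ∈ W s) ∧
    iSupIndep W ∧ (⨆ s : ℂ × ℂ, W s) = ⊤ := by
  have hzC : ∀ X : Module.End ℂ V, Commute X C → Commute X ((d : ℂ) • C ^ (d - 1)) :=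
    fun X hX => (hX.pow_right _).smul_right _
  have hAC : Commute A C := h2.symm
  have hBC : Commute B C := h1
  have hAB : ∀ μ, Set.MapsTo B (A.maxGenEigenspace μ) (A.maxGenEigenspace μ) := fun μ =>
    mapsTo_aux A B _ (hzC A hAC).neg_right (by rw [← h3]; abel) μ
  have hBA : ∀ μ, Set.MapsTo A (B.maxGenEigenspace μ) (B.maxGenEigenspace μ) := fun μ =>
    mapsTo_aux B A _ (hzC B hBC) (by rw [← neg_neg ((d : ℂ) • C ^ (d - 1)), ← h3]; abel) μ
  have hAA : ∀ μ, Set.MapsTo A (A.maxGenEigenspace μ) (A.maxGenEigenspace μ) := fun μ =>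
    Module.End.mapsTo_maxGenEigenspace_of_comm (Commute.refl A) μ
  have hBB : ∀ μ, Set.MapsTo B (B.maxGenEigenspace μ) (B.maxGenEigenspace μ) := fun μ =>
    Module.End.mapsTo_maxGenEigenspace_of_comm (Commute.refl B) μ
  have hAC' : ∀ μ, Set.MapsTo C (A.maxGenEigenspace μ) (A.maxGenEigenspace μ) := fun μ =>
    Module.End.mapsTo_maxGenEigenspace_of_comm hAC μ
  have hBC' : ∀ μ, Set.MapsTo C (B.maxGenEigenspace μ) (B.maxGenEigenspace μ) := fun μ =>
    Module.End.mapsTo_maxGenEigenspace_of_comm hBC μ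
  simp only [genEig_eq] at hW
  let f : Bool → Module.End ℂ V := fun b => bif b then B else A
  have hf : ∀ i j φ, Set.MapsTo (f i) ((f j).maxGenEigenspace φ) ((f j).maxGenEigenspace φ) := by
    intro i j φ
    cases i <;> cases j
    exacts [hAA φ, hBA φ, hAB φ, hBB φ]
  have hWf : W = (fun χ : Bool → ℂ => ⨅ i, (f i).maxGenEigenspace (χ i)) ∘
      (Equiv.boolArrowEquivProd ℂ).symm := by
    funext s
    rw [hW s, Function.comp_apply, iInf_bool_eq, inf_comm]
    rfl
  refine ⟨?_, ?_, ?_, ?_, ?_⟩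
  · intro s v hv
    rw [hW] at hv ⊢
    exact ⟨hAA _ hv.1, hBA _ hv.2⟩
  · intro s v hv
    rw [hW] at hv ⊢
    exact ⟨hAB _ hv.1, hBB _ hv.2⟩
  · intro s v hv
    rw [hW] at hv ⊢
    exact ⟨hAC' _ hv.1, hBC' _ hv.2⟩
  · rw [hWf]
    exact (Module.End.independent_iInf_maxGenEigenspace_of_forall_mapsTo f hf).comp
      (Equiv.injective _)
  · rw [hWf]
    have := Module.End.iSup_iInf_maxGenEigenspace_eq_top_of_forall_mapsTo f hf
      (fun i => Module.End.iSup_maxGenEigenspace_eq_top (f i))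
    rw [← this]
    exact Equiv.iSup_comp (g := fun χ : Bool → ℂ => ⨅ i, (f i).maxGenEigenspace (χ i))
      (Equiv.boolArrowEquivProd ℂ).symm
end
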